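/- arXiv:2503.22004 — 11 statements merged into one kernel-verified Lean document; each statement's English description precedes it below -/
import Mathlib

section
/- Let X be a real Hilbert space, let C be a nonempty subset of X, and let (x_n) be a sequence in X that is Opial with respect to C. If w1 and w2 are weak cluster points of (x_n), then w1 − w2 is orthogonal to C − C, i.e. ⟪w1 − w2, c1 − c2⟫ = 0 for all c1, c2 ∈ C. -/
open Filter Topology RealInnerProductSpace

/-- Location of weak cluster points: if `(x n)` is Opial with respect to a nonempty set `C`
and `w₁, w₂` are weak cluster points of `(x n)`, then `w₁ - w₂ ⟂ (C - C)`. -/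
theorem opial_weak_cluster_points
    {X : Type*} [NormedAddCommGroup X] [InnerProductSpace ℝ X] [CompleteSpace X]
    (C : Set X) (hC : C.Nonempty) (x : ℕ → X)
    (hOpial : ∀ c ∈ C, ∃ l : ℝ, Tendsto (fun n => ‖x n - c‖) atTop (𝓝 l))
    (w₁ w₂ : X)
    (hw₁ : ∃ k : ℕ → ℕ, StrictMono k ∧
      ∀ y : X, Tendsto (fun n => ⟪x (k n), y⟫) atTop (𝓝 ⟪w₁, y⟫))
    (hw₂ : ∃ k : ℕ → ℕ, StrictMono k ∧
      ∀ y : X, Tendsto (fun n => ⟪x (k n), y⟫) atTop (𝓝 ⟪w₂, y⟫)) :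
    ∀ c₁ ∈ C, ∀ c₂ ∈ C, ⟪w₁ - w₂, c₁ - c₂⟫ = 0 := by
  intro c₁ h₁ c₂ h₂
  obtain ⟨l₁, hl₁⟩ := hOpial c₁ h₁
  obtain ⟨l₂, hl₂⟩ := hOpial c₂ h₂
  obtain ⟨k₁, hk₁, hx₁⟩ := hw₁
  obtain ⟨k₂, hk₂, hx₂⟩ := hw₂
  have polarization (z : X) :
      (‖z - c₂‖ ^ 2 - ‖z - c₁‖ ^ 2 + (‖c₁‖ ^ 2 - ‖c₂‖ ^ 2)) / 2 = ⟪z, c₁ - c₂⟫ := by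
    rw [norm_sub_sq_real, norm_sub_sq_real, inner_sub_right]
    ring
  have hlim : Tendsto (fun n => ⟪x n, c₁ - c₂⟫) atTop
      (𝓝 ((l₂ ^ 2 - l₁ ^ 2 + (‖c₁‖ ^ 2 - ‖c₂‖ ^ 2)) / 2)) :=
    ((((hl₂.pow 2).sub (hl₁.pow 2)).add_const (‖c₁‖ ^ 2 - ‖c₂‖ ^ 2)).div_const 2).congr
      fun n => polarization (x n)
  rw [inner_sub_left, sub_eq_zero]
  exact (tendsto_nhds_unique (hx₁ _) (hlim.comp hk₁.tendsto_atTop)).trans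
    (tendsto_nhds_unique (hx₂ _) (hlim.comp hk₂.tendsto_atTop)).symm
end

section
/- Let X be a real Hilbert space, let C be a nonempty subset of X, and let (x_n) be a sequence in X that is Opial with respect to C. Then (x_n) converges weakly to some point of C if and only if every weak cluster point of (x_n) lies in C. -/
open Filter Topology RealInnerProductSpace

/-- A bounded sequence in a real Hilbert space has a weakly convergent subsequence. -/
theorem exists_strictMono_tendsto_inner_of_norm_le
    {X : Type*} [NormedAddCommGroup X] [InnerProductSpace ℝ X] [CompleteSpace X]
    {x : ℕ → X} {R : ℝ} (hx : ∀ n, ‖x n‖ ≤ R) :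
    ∃ w : X, ∃ k : ℕ → ℕ, StrictMono k ∧
      ∀ y : X, Tendsto (fun n => ⟪x (k n), y⟫) atTop (𝓝 ⟪w, y⟫) := by
  let K : Submodule ℝ X := (Submodule.span ℝ (Set.range x)).topologicalClosure
  have hxK (n : ℕ) : x n ∈ K :=
    Submodule.le_topologicalClosure _ (Submodule.subset_span (Set.mem_range_self n))
  have : CompleteSpace K := (Submodule.isClosed_topologicalClosure _).completeSpace_coe
  have : TopologicalSpace.SeparableSpace K :=
    ((Set.countable_range x).isSeparable.span (R := ℝ)).closure.separableSpace
  let f : ℕ → WeakDual ℝ K := fun n =>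
    StrongDual.toWeakDual (InnerProductSpace.toDual ℝ K ⟨x n, hxK n⟩)
  have hf (n : ℕ) :
      f n ∈ WeakDual.toStrongDual ⁻¹' Metric.closedBall (0 : StrongDual ℝ K) R := by
    change dist (InnerProductSpace.toDual ℝ K ⟨x n, hxK n⟩) 0 ≤ R
    rw [dist_zero_right, LinearIsometryEquiv.norm_map]
    exact hx n
  obtain ⟨g, -, k, hk, hg⟩ := WeakDual.isSeqCompact_closedBall ℝ K 0 R hf
  refine ⟨((InnerProductSpace.toDual ℝ K).symm (WeakDual.toStrongDual g) : K), k, hk,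
    fun y => ?_⟩
  have h := ((WeakDual.eval_continuous (K.orthogonalProjectionOnto y)).tendsto g).comp hg
  have inner_proj (u : K) : ⟪(u : X), y⟫ = ⟪u, K.orthogonalProjectionOnto y⟫ :=
    (Submodule.inner_orthogonalProjectionOnto_eq_of_mem_left u y).symm
  rw [inner_proj, InnerProductSpace.toDual_symm_apply]
  refine h.congr fun n => ?_
  exact (inner_proj ⟨x (k n), hxK (k n)⟩).symm

/-- If the distances from `x n` to `a` and to `b` converge, then so does `⟪x n, a - b⟫`. -/
theorem exists_tendsto_inner_sub_of_tendsto_norm_sub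
    {X α : Type*} [NormedAddCommGroup X] [InnerProductSpace ℝ X] {l : Filter α} {x : α → X}
    {a b : X} {r s : ℝ} (ha : Tendsto (fun n => ‖x n - a‖) l (𝓝 r))
    (hb : Tendsto (fun n => ‖x n - b‖) l (𝓝 s)) :
    ∃ t : ℝ, Tendsto (fun n => ⟪x n, a - b⟫) l (𝓝 t) := by
  refine ⟨(s ^ 2 - r ^ 2 + ‖a‖ ^ 2 - ‖b‖ ^ 2) / 2,
    (((((hb.pow 2).sub (ha.pow 2)).add_const _).sub_const _).div_const 2).congr fun n => ?_⟩
  rw [norm_sub_sq_real, norm_sub_sq_real, inner_sub_right]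
  ring

/-- Opial's Lemma: an Opial sequence converges weakly to a point of `C` iff all of its
weak cluster points lie in `C`. -/
theorem opial_lemma
    {X : Type*} [NormedAddCommGroup X] [InnerProductSpace ℝ X] [CompleteSpace X]
    (C : Set X) (hC : C.Nonempty) (x : ℕ → X)
    (hOpial : ∀ c ∈ C, ∃ l : ℝ, Tendsto (fun n => ‖x n - c‖) atTop (𝓝 l)) :
    (∃ p ∈ C, ∀ y : X, Tendsto (fun n => ⟪x n, y⟫) atTop (𝓝 ⟪p, y⟫)) ↔
    (∀ w : X, (∃ k : ℕ → ℕ, StrictMono k ∧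
        ∀ y : X, Tendsto (fun n => ⟪x (k n), y⟫) atTop (𝓝 ⟪w, y⟫)) → w ∈ C) := by
  constructor
  · rintro ⟨p, hp, hxp⟩ w ⟨k, hk, hw⟩
    have : w = p := ext_inner_right ℝ fun y =>
      tendsto_nhds_unique (hw y) ((hxp y).comp hk.tendsto_atTop)
    rwa [this]
  · intro hcl
    obtain ⟨c, hc⟩ := hC
    obtain ⟨r, hr⟩ := hOpial c hc
    obtain ⟨B, hB⟩ := hr.bddAbove_range
    have hx (n : ℕ) : ‖x n‖ ≤ B + ‖c‖ := by
      have h₁ : ‖x n - c‖ ≤ B := hB (Set.mem_range_self n)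
      have h₂ : ‖x n‖ ≤ ‖x n - c‖ + ‖c‖ := by simpa using norm_add_le (x n - c) c
      linarith
    obtain ⟨p, k, hk, hp⟩ := exists_strictMono_tendsto_inner_of_norm_le hx
    have hpC : p ∈ C := hcl p ⟨k, hk, hp⟩
    refine ⟨p, hpC, fun y => tendsto_of_subseq_tendsto fun ns hns => ?_⟩
    obtain ⟨φ, -, hnsφ⟩ := strictMono_subseq_of_tendsto_atTop hns
    obtain ⟨w, j, hj, hw⟩ :=
      exists_strictMono_tendsto_inner_of_norm_le fun n => hx (ns (φ n))
    have hm : StrictMono fun n => ns (φ (j n)) := hnsφ.comp hj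
    have hwC : w ∈ C := hcl w ⟨_, hm, hw⟩
    obtain ⟨s, hs⟩ := hOpial p hpC
    obtain ⟨t, ht⟩ := hOpial w hwC
    obtain ⟨u, hu⟩ := exists_tendsto_inner_sub_of_tendsto_norm_sub hs ht
    have hpu : ⟪p, p - w⟫ = u := tendsto_nhds_unique (hp _) (hu.comp hk.tendsto_atTop)
    have hwu : ⟪w, p - w⟫ = u := tendsto_nhds_unique (hw _) (hu.comp hm.tendsto_atTop)
    have hpw : p = w := by
      rw [← sub_eq_zero, ← inner_self_eq_zero (𝕜 := ℝ), inner_sub_left, hpu, hwu, sub_self]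
    exact ⟨fun n => φ (j n), hpw ▸ hw y⟩
end

section
/- Let X be a real Hilbert space, let C be a nonempty subset of X, and let (x_n) be a sequence in X that is Opial with respect to C. If the closure of the affine span of C equals X, then (x_n) converges weakly to some point of X. -/
open Filter Topology RealInnerProductSpace

theorem exists_norm_le_of_tendsto_norm_sub {X : Type*} [SeminormedAddCommGroup X]
    {x : ℕ → X} {c : X} {l : ℝ}
    (hc : Tendsto (fun n => ‖x n - c‖) atTop (𝓝 l)) : ∃ R, ∀ n, ‖x n‖ ≤ R := by
  obtain ⟨R, hR⟩ := hc.bddAbove_range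
  refine ⟨R + ‖c‖, fun n => ?_⟩
  have hn : ‖x n - c‖ ≤ R := hR ⟨n, rfl⟩
  linarith [norm_le_norm_sub_add (x n) c]

section WeakConvergenceSubmodule

variable {X : Type*} [NormedAddCommGroup X] [InnerProductSpace ℝ X]

/-- The directions along which the inner products with a sequence converge. -/
def innerConvergenceSubmodule (x : ℕ → X) : Submodule ℝ X where
  carrier := {y | ∃ l : ℝ, Tendsto (fun n => ⟪x n, y⟫) atTop (𝓝 l)}
  zero_mem' := ⟨0, by simp⟩
  add_mem' := by
    rintro y z ⟨l, hl⟩ ⟨m, hm⟩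
    exact ⟨l + m, by simpa only [inner_add_right] using hl.add hm⟩
  smul_mem' := by
    rintro a y ⟨l, hl⟩
    exact ⟨a * l, by simpa only [real_inner_smul_right] using hl.const_mul a⟩

theorem mem_innerConvergenceSubmodule {x : ℕ → X} {y : X} :
    y ∈ innerConvergenceSubmodule x ↔ ∃ l : ℝ, Tendsto (fun n => ⟪x n, y⟫) atTop (𝓝 l) :=
  Iff.rfl

theorem isClosed_innerConvergenceSubmodule {x : ℕ → X} {R : ℝ} (hR : ∀ n, ‖x n‖ ≤ R) :
    IsClosed (innerConvergenceSubmodule x : Set X) := by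
  refine isClosed_of_closure_subset fun y hy => ?_
  refine cauchySeq_tendsto_of_complete (Metric.cauchySeq_iff.2 fun ε hε => ?_)
  have hR0 : 0 ≤ R := (norm_nonneg _).trans (hR 0)
  obtain ⟨z, ⟨l, hl⟩, hyz⟩ := Metric.mem_closure_iff.1 hy (ε / (3 * (R + 1))) (by positivity)
  obtain ⟨N, hN⟩ := Metric.cauchySeq_iff.1 hl.cauchySeq (ε / 3) (by positivity)
  have hclose : ∀ n, |⟪x n, y⟫ - ⟪x n, z⟫| ≤ ε / 3 := fun n => by
    rw [← inner_sub_right]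
    calc |⟪x n, y - z⟫| ≤ ‖x n‖ * ‖y - z‖ := abs_real_inner_le_norm _ _
      _ ≤ (R + 1) * (ε / (3 * (R + 1))) := by
        gcongr
        · linarith [hR n]
        · exact (dist_eq_norm y z ▸ hyz).le
      _ = ε / 3 := by field_simp
  refine ⟨N, fun m hm n hn => ?_⟩
  have hmn := hN m hm n hn
  rw [Real.dist_eq, abs_lt] at hmn ⊢
  have hm' := abs_le.1 (hclose m)
  have hn' := abs_le.1 (hclose n)
  constructor <;> linarith

theorem sub_mem_innerConvergenceSubmodule {x : ℕ → X} {c d : X} {l m : ℝ}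
    (hc : Tendsto (fun n => ‖x n - c‖) atTop (𝓝 l))
    (hd : Tendsto (fun n => ‖x n - d‖) atTop (𝓝 m)) :
    c - d ∈ innerConvergenceSubmodule x := by
  refine ⟨(m ^ 2 - l ^ 2 + (‖c‖ ^ 2 - ‖d‖ ^ 2)) / 2,
    ((((hd.pow 2).sub (hc.pow 2)).add_const _).div_const 2).congr fun n => ?_⟩
  rw [norm_sub_sq_real, norm_sub_sq_real, inner_sub_right]
  ring

theorem exists_weak_limit_of_innerConvergenceSubmodule_eq_top [CompleteSpace X] {x : ℕ → X}
    (hx : innerConvergenceSubmodule x = ⊤) :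
    ∃ p : X, ∀ y : X, Tendsto (fun n => ⟪x n, y⟫) atTop (𝓝 ⟪p, y⟫) := by
  have hlim : ∀ y : X, ∃ l : ℝ, Tendsto (fun n => ⟪x n, y⟫) atTop (𝓝 l) := fun y =>
    mem_innerConvergenceSubmodule.1 (hx ▸ Submodule.mem_top)
  choose f hf using hlim
  let F : StrongDual ℝ X := continuousLinearMapOfTendsto (l := atTop) (f := f)
    (fun n => InnerProductSpace.toDual ℝ X (x n)) (tendsto_pi_nhds.2 hf)
  refine ⟨(InnerProductSpace.toDual ℝ X).symm F, fun y => ?_⟩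
  rw [InnerProductSpace.toDual_symm_apply]
  exact hf y

end WeakConvergenceSubmodule

/-- If the closed affine span of the Opial set `C` is the whole space, then the Opial
sequence converges weakly. -/
theorem opial_large_set_weak_convergence
    {X : Type*} [NormedAddCommGroup X] [InnerProductSpace ℝ X] [CompleteSpace X]
    (C : Set X) (hC : C.Nonempty) (x : ℕ → X)
    (hOpial : ∀ c ∈ C, ∃ l : ℝ, Tendsto (fun n => ‖x n - c‖) atTop (𝓝 l))
    (hspan : closure ((affineSpan ℝ C : AffineSubspace ℝ X) : Set X) = Set.univ) :
    ∃ p : X, ∀ y : X, Tendsto (fun n => ⟪x n, y⟫) atTop (𝓝 ⟪p, y⟫) := by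
  obtain ⟨c₀, hc₀⟩ := hC
  obtain ⟨l₀, hl₀⟩ := hOpial c₀ hc₀
  obtain ⟨R, hR⟩ := exists_norm_le_of_tendsto_norm_sub hl₀
  have hle : affineSpan ℝ C ≤ AffineSubspace.mk' c₀ (innerConvergenceSubmodule x) :=
    affineSpan_le.2 fun c hc => by
      obtain ⟨l, hl⟩ := hOpial c hc
      exact sub_mem_innerConvergenceSubmodule hl hl₀
  have hclosed : IsClosed {z : X | z - c₀ ∈ innerConvergenceSubmodule x} :=
    (isClosed_innerConvergenceSubmodule hR).preimage (continuous_id.sub continuous_const)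
  have hsub : closure (affineSpan ℝ C : Set X) ⊆
      {z : X | z - c₀ ∈ innerConvergenceSubmodule x} :=
    closure_minimal (fun z hz => hle hz) hclosed
  refine exists_weak_limit_of_innerConvergenceSubmodule_eq_top
    (Submodule.eq_top_iff'.2 fun y => ?_)
  have hy : y + c₀ - c₀ ∈ innerConvergenceSubmodule x := hsub (hspan ▸ Set.mem_univ (y + c₀))
  rwa [add_sub_cancel_right] at hy
end

section
/- Let X be a real Hilbert space, let C be a nonempty subset of X, and let (x_n) be a sequence in X that is Opial with respect to C. Then (x_n) is also Opial with respect to the closure of the affine span of C. -/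
open Filter Topology

/-- In a real inner product space, the set of points to which the distances from a given
sequence converge is an affine subspace. -/
def opialSubspace {X : Type*} [NormedAddCommGroup X] [InnerProductSpace ℝ X] (x : ℕ → X) :
    AffineSubspace ℝ X where
  carrier := {c | ∃ l : ℝ, Tendsto (fun n => ‖x n - c‖) atTop (𝓝 l)}
  smul_vsub_vadd_mem' := by
    rintro a p q r ⟨lp, hp⟩ ⟨lq, hq⟩ ⟨lr, hr⟩
    have key : ∀ n, ‖x n - (a • (p -ᵥ q) +ᵥ r)‖ ^ 2 =
        ‖x n - r‖ ^ 2 + a * (‖x n - p‖ ^ 2 - ‖x n - q‖ ^ 2) +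
          (‖a • (p - q) + r‖ ^ 2 - ‖r‖ ^ 2 - a * (‖p‖ ^ 2 - ‖q‖ ^ 2)) := by
      intro n
      simp only [vsub_eq_sub, vadd_eq_add, norm_sub_sq_real (x n), inner_add_right,
        inner_smul_right, inner_sub_right]
      ring
    have lim := (((hr.pow 2).add (((hp.pow 2).sub (hq.pow 2)).const_mul a)).add_const
      (‖a • (p - q) + r‖ ^ 2 - ‖r‖ ^ 2 - a * (‖p‖ ^ 2 - ‖q‖ ^ 2))).sqrt
    refine ⟨_, lim.congr fun n => ?_⟩
    rw [← key n, Real.sqrt_sq (norm_nonneg _)]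

theorem isClosed_setOf_exists_tendsto_norm_sub {X : Type*} [SeminormedAddCommGroup X]
    (x : ℕ → X) :
    IsClosed {c | ∃ l : ℝ, Tendsto (fun n => ‖x n - c‖) atTop (𝓝 l)} := by
  refine isClosed_of_closure_subset fun c hc => cauchySeq_tendsto_of_complete ?_
  rw [Metric.cauchySeq_iff]
  intro ε hε
  obtain ⟨d, ⟨l, hd⟩, hcd⟩ := Metric.mem_closure_iff.1 hc (ε / 3) (by positivity)
  obtain ⟨N, hN⟩ := Metric.cauchySeq_iff.1 hd.cauchySeq (ε / 3) (by positivity)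
  have close : ∀ n, |‖x n - c‖ - ‖x n - d‖| < ε / 3 := fun n => by
    refine (abs_norm_sub_norm_le _ _).trans_lt ?_
    rwa [sub_sub_sub_cancel_left, ← dist_eq_norm, dist_comm]
  refine ⟨N, fun m hm n hn => ?_⟩
  have h₁ := abs_lt.1 (close m)
  have h₂ := abs_lt.1 (close n)
  have h₃ := hN m hm n hn
  rw [Real.dist_eq, abs_lt] at h₃ ⊢
  constructor <;> linarith

/-- An Opial sequence with respect to `C` is also Opial with respect to the closure of
the affine span of `C`. -/
theorem opial_wrt_closure_affineSpan
    {X : Type*} [NormedAddCommGroup X] [InnerProductSpace ℝ X] [CompleteSpace X]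
    (C : Set X) (hC : C.Nonempty) (x : ℕ → X)
    (hOpial : ∀ c ∈ C, ∃ l : ℝ, Tendsto (fun n => ‖x n - c‖) atTop (𝓝 l)) :
    ∀ c ∈ closure ((affineSpan ℝ C : AffineSubspace ℝ X) : Set X),
      ∃ l : ℝ, Tendsto (fun n => ‖x n - c‖) atTop (𝓝 l) := by
  have hspan : affineSpan ℝ C ≤ opialSubspace x := affineSpan_le.2 hOpial
  exact closure_minimal hspan (isClosed_setOf_exists_tendsto_norm_sub x)
end

section
/- Let X be a real Hilbert space and let (x_n) be a sequence in X that is Opial with respect to X (the whole space). Then (x_n) converges weakly to some point of X. -/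
open Filter Topology RealInnerProductSpace

/-- A sequence that is Opial with respect to the whole space is weakly convergent. -/
theorem opial_wrt_univ_weak_convergence
    {X : Type*} [NormedAddCommGroup X] [InnerProductSpace ℝ X] [CompleteSpace X]
    (x : ℕ → X)
    (hOpial : ∀ c : X, ∃ l : ℝ, Tendsto (fun n => ‖x n - c‖) atTop (𝓝 l)) :
    ∃ p : X, ∀ y : X, Tendsto (fun n => ⟪x n, y⟫) atTop (𝓝 ⟪p, y⟫) := by
  choose l hl using hOpial
  have hinner (y : X) : Tendsto (fun n => ⟪x n, y⟫) atTop
      (𝓝 ((l 0 ^ 2 + ‖y‖ ^ 2 - l y ^ 2) / 2)) := by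
    refine (((((hl 0).pow 2).add_const (‖y‖ ^ 2)).sub ((hl y).pow 2)).div_const 2).congr
      fun n => ?_
    rw [sub_zero, norm_sub_sq_real]
    ring
  let f : X →L[ℝ] ℝ := continuousLinearMapOfTendsto (fun n => innerSL ℝ (x n))
    (f := fun y => (l 0 ^ 2 + ‖y‖ ^ 2 - l y ^ 2) / 2) (tendsto_pi_nhds.2 hinner)
  refine ⟨(InnerProductSpace.toDual ℝ X).symm f, fun y => ?_⟩
  rw [InnerProductSpace.toDual_symm_apply]
  exact hinner y
end

section
/- Let X be a real Hilbert space and let (x_n) be a sequence in X. Then (x_n) is Opial with respect to X (the whole space) if and only if (x_n) converges weakly to some point of X and the real sequence (‖x_n‖) is convergent. -/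
open Filter Topology RealInnerProductSpace

/-- In a Hilbert space, a sequence whose inner products with every vector converge is weakly
convergent. -/
theorem exists_tendsto_inner_of_forall_exists_tendsto
    {X : Type*} [NormedAddCommGroup X] [InnerProductSpace ℝ X] [CompleteSpace X]
    {x : ℕ → X} (h : ∀ y : X, ∃ l : ℝ, Tendsto (fun n => ⟪x n, y⟫) atTop (𝓝 l)) :
    ∃ p : X, ∀ y : X, Tendsto (fun n => ⟪x n, y⟫) atTop (𝓝 ⟪p, y⟫) := by
  choose f hf using h
  have hlim : Tendsto (fun n y => innerSL ℝ (x n) y) atTop (𝓝 f) :=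
    tendsto_pi_nhds.2 fun y => by simpa using hf y
  let F : X →L[ℝ] ℝ := continuousLinearMapOfTendsto (fun n => innerSL ℝ (x n)) hlim
  refine ⟨(InnerProductSpace.toDual ℝ X).symm F, fun y => ?_⟩
  rw [InnerProductSpace.toDual_symm_apply]
  exact hf y

/-- A sequence is Opial with respect to the whole space iff it is weakly convergent and
the sequence of norms converges. -/
theorem opial_wrt_univ_iff
    {X : Type*} [NormedAddCommGroup X] [InnerProductSpace ℝ X] [CompleteSpace X]
    (x : ℕ → X) :
    (∀ c : X, ∃ l : ℝ, Tendsto (fun n => ‖x n - c‖) atTop (𝓝 l)) ↔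
    ((∃ p : X, ∀ y : X, Tendsto (fun n => ⟪x n, y⟫) atTop (𝓝 ⟪p, y⟫)) ∧
      (∃ l : ℝ, Tendsto (fun n => ‖x n‖) atTop (𝓝 l))) := by
  constructor
  · intro h
    have hnorm : ∃ l : ℝ, Tendsto (fun n => ‖x n‖) atTop (𝓝 l) := by simpa using h 0
    refine ⟨exists_tendsto_inner_of_forall_exists_tendsto fun y => ?_, hnorm⟩
    obtain ⟨a, ha⟩ := hnorm
    obtain ⟨b, hb⟩ := h y
    refine ⟨(a ^ 2 + ‖y‖ ^ 2 - b ^ 2) / 2,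
      ((((ha.pow 2).add_const (‖y‖ ^ 2)).sub (hb.pow 2)).div_const 2).congr fun n => ?_⟩
    rw [norm_sub_sq_real]
    ring
  · rintro ⟨⟨p, hp⟩, a, ha⟩ c
    refine ⟨√(a ^ 2 - 2 * ⟪p, c⟫ + ‖c‖ ^ 2),
      (((ha.pow 2).sub ((hp c).const_mul 2)).add_const (‖c‖ ^ 2)).sqrt.congr fun n => ?_⟩
    rw [← norm_sub_sq_real, Real.sqrt_sq (norm_nonneg _)]
end

section
/- Let X be a real Hilbert space, let C be a nonempty closed convex subset of X, and let (c_n) be a sequence lying in C that is Opial with respect to C. Then (c_n) converges weakly to a point ĉ ∈ C, and ĉ satisfies limsup_n ‖c_n − ĉ‖ < limsup_n ‖c_n − c‖ for every c ∈ C with c ≠ ĉ (i.e. ĉ is the asymptotic center of (c_n) with respect to C). -/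
open Filter Topology RealInnerProductSpace

section WeakConvergence

variable {X : Type*} [NormedAddCommGroup X] [InnerProductSpace ℝ X]

/-- The vectors against which the inner products of a sequence form a Cauchy sequence. -/
def weakCauchySubmodule (u : ℕ → X) : Submodule ℝ X where
  carrier := {y | CauchySeq fun n => ⟪u n, y⟫}
  add_mem' {x y} hx hy := by
    simpa only [Set.mem_ofPred_eq, inner_add_right] using! CauchySeq.add hx hy
  zero_mem' := by simpa using cauchySeq_const (0 : ℝ)
  smul_mem' r y hy := by
    obtain ⟨l, hl⟩ := cauchySeq_tendsto_of_complete hy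
    simpa only [Set.mem_ofPred_eq, real_inner_smul_right] using (hl.const_mul r).cauchySeq

theorem mem_weakCauchySubmodule {u : ℕ → X} {y : X} :
    y ∈ weakCauchySubmodule u ↔ CauchySeq fun n => ⟪u n, y⟫ := Iff.rfl

theorem isClosed_weakCauchySubmodule {u : ℕ → X} {B : ℝ} (hB : ∀ n, ‖u n‖ ≤ B) :
    IsClosed (weakCauchySubmodule u : Set X) := by
  refine isClosed_of_closure_subset fun y hy => ?_
  have hB0 : 0 ≤ B := (norm_nonneg _).trans (hB 0)
  refine Metric.cauchySeq_iff.2 fun ε hε => ?_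
  obtain ⟨z, hz, hyz⟩ := Metric.mem_closure_iff.1 hy (ε / (3 * (B + 1))) (by positivity)
  obtain ⟨N, hN⟩ := Metric.cauchySeq_iff.1 (mem_weakCauchySubmodule.1 hz) (ε / 3) (by positivity)
  have hclose (n : ℕ) : |⟪u n, y⟫ - ⟪u n, z⟫| ≤ ε / 3 := by
    rw [← inner_sub_right]
    calc |⟪u n, y - z⟫| ≤ ‖u n‖ * ‖y - z‖ := abs_real_inner_le_norm _ _
      _ ≤ (B + 1) * (ε / (3 * (B + 1))) := by
        rw [dist_eq_norm] at hyz
        gcongr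
        linarith [hB n]
      _ = ε / 3 := by field_simp
  refine ⟨N, fun m hm n hn => ?_⟩
  have hmn := hN m hm n hn
  have hm' := hclose m
  have hn' := hclose n
  rw [Real.dist_eq] at hmn ⊢
  rw [abs_le] at hm' hn'
  rw [abs_lt] at hmn ⊢
  constructor <;> linarith

/-- A sequence whose inner products against every vector form a Cauchy sequence
converges weakly. -/
theorem exists_weak_limit_of_cauchySeq_inner [CompleteSpace X] {u : ℕ → X}
    (hu : ∀ y, CauchySeq fun n => ⟪u n, y⟫) :
    ∃ x : X, ∀ y, Tendsto (fun n => ⟪u n, y⟫) atTop (𝓝 ⟪x, y⟫) := by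
  choose f hf using fun y => cauchySeq_tendsto_of_complete (hu y)
  let F : X →L[ℝ] ℝ := continuousLinearMapOfTendsto (fun n => innerSL ℝ (u n))
    (tendsto_pi_nhds.2 hf)
  refine ⟨(InnerProductSpace.toDual ℝ X).symm F, fun y => ?_⟩
  rw [InnerProductSpace.toDual_symm_apply]
  exact hf y

/-- A bounded sequence in a Hilbert space converges weakly as soon as its inner products against
each of its own terms form a Cauchy sequence. -/
theorem exists_weak_limit_of_cauchySeq_inner_self [CompleteSpace X] {u : ℕ → X} {B : ℝ}
    (hB : ∀ n, ‖u n‖ ≤ B) (hu : ∀ m, CauchySeq fun n => ⟪u n, u m⟫) :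
    ∃ x : X, ∀ y, Tendsto (fun n => ⟪u n, y⟫) atTop (𝓝 ⟪x, y⟫) := by
  have hle : (weakCauchySubmodule u)ᗮ ≤ weakCauchySubmodule u := fun y hy => by
    have hzero (n : ℕ) : ⟪u n, y⟫ = 0 := (Submodule.mem_orthogonal _ _).1 hy _ (hu n)
    simpa only [mem_weakCauchySubmodule, hzero] using cauchySeq_const (0 : ℝ)
  have : CompleteSpace (weakCauchySubmodule u) :=
    (isClosed_weakCauchySubmodule hB).completeSpace_coe
  have htop : weakCauchySubmodule u = ⊤ := by
    rw [← sup_eq_left.2 hle]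
    exact Submodule.sup_orthogonal_of_hasOrthogonalProjection
  refine exists_weak_limit_of_cauchySeq_inner fun y => mem_weakCauchySubmodule.1 ?_
  rw [htop]
  exact Submodule.mem_top

/-- A closed convex subset of a Hilbert space is weakly sequentially closed. -/
theorem mem_of_weak_limit_of_isClosed_of_convex [CompleteSpace X] {C : Set X}
    (hCclosed : IsClosed C) (hCconv : Convex ℝ C) {u : ℕ → X} (hu : ∀ n, u n ∈ C) {x : X}
    (hx : ∀ y, Tendsto (fun n => ⟪u n, y⟫) atTop (𝓝 ⟪x, y⟫)) : x ∈ C := by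
  obtain ⟨p, hp, hpx⟩ :=
    exists_norm_eq_iInf_of_complete_convex ⟨u 0, hu 0⟩ hCclosed.isComplete hCconv x
  have hproj := (norm_eq_iInf_iff_real_inner_le_zero hCconv hp).1 hpx
  have hlim : ⟪x, x - p⟫ - ⟪p, x - p⟫ ≤ 0 :=
    le_of_tendsto ((hx (x - p)).sub_const _) <| .of_forall fun n => by
      rw [← inner_sub_left, real_inner_comm]
      exact hproj _ (hu n)
  rw [← inner_sub_left] at hlim
  rw [real_inner_self_nonpos, sub_eq_zero] at hlim
  rwa [hlim]

/-- Along a weakly convergent sequence, the limiting distance to the weak limit is strictly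
smaller than the limiting distance to any other point. -/
theorem lt_of_tendsto_norm_sub_of_weak_limit {u : ℕ → X} {x c : X} {l m : ℝ}
    (hx : ∀ y, Tendsto (fun n => ⟪u n, y⟫) atTop (𝓝 ⟪x, y⟫)) (hcx : c ≠ x)
    (hl : Tendsto (fun n => ‖u n - x‖) atTop (𝓝 l))
    (hm : Tendsto (fun n => ‖u n - c‖) atTop (𝓝 m)) : l < m := by
  have hexp (n : ℕ) : ‖u n - c‖ ^ 2 =
      ‖u n - x‖ ^ 2 + 2 * (⟪u n, x - c⟫ - ⟪x, x - c⟫) + ‖x - c‖ ^ 2 := by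
    rw [← inner_sub_left, ← norm_add_sq_real, sub_add_sub_cancel]
  have hlim := ((hl.pow 2).add (((hx (x - c)).sub_const ⟪x, x - c⟫).const_mul 2)).add_const
    (‖x - c‖ ^ 2)
  have hsq : m ^ 2 = l ^ 2 + 2 * (⟪x, x - c⟫ - ⟪x, x - c⟫) + ‖x - c‖ ^ 2 :=
    tendsto_nhds_unique (hm.pow 2) (hlim.congr fun n => (hexp n).symm)
  have hm0 : 0 ≤ m := ge_of_tendsto' hm fun n => norm_nonneg _
  have hpos : 0 < ‖x - c‖ := norm_pos_iff.2 (sub_ne_zero.2 hcx.symm)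
  refine lt_of_pow_lt_pow_left₀ 2 hm0 ?_
  nlinarith

/-- If the distances from a sequence to `a` and to `c` converge, then so do its inner products,
centred at `a`, against `c - a`. -/
theorem cauchySeq_inner_sub_of_tendsto_norm_sub {u : ℕ → X} {a c : X} {l m : ℝ}
    (hl : Tendsto (fun n => ‖u n - a‖) atTop (𝓝 l))
    (hm : Tendsto (fun n => ‖u n - c‖) atTop (𝓝 m)) :
    CauchySeq fun n => ⟪u n - a, c - a⟫ := by
  refine ((((hl.pow 2).add_const (‖c - a‖ ^ 2)).sub (hm.pow 2)).div_const 2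
    |>.congr fun n => ?_).cauchySeq
  have h := norm_sub_sq_real (u n - a) (c - a)
  rw [sub_sub_sub_cancel_right] at h
  linarith

end WeakConvergence

/-- A sequence lying in a nonempty closed convex set `C` that is Opial with respect to
`C` converges weakly to its asymptotic center with respect to `C`. -/
theorem opial_in_set_weak_convergence_to_asymptotic_center
    {X : Type*} [NormedAddCommGroup X] [InnerProductSpace ℝ X] [CompleteSpace X]
    (C : Set X) (hC : C.Nonempty) (hCclosed : IsClosed C) (hCconv : Convex ℝ C)
    (c' : ℕ → X) (hmem : ∀ n, c' n ∈ C)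
    (hOpial : ∀ c ∈ C, ∃ l : ℝ, Tendsto (fun n => ‖c' n - c‖) atTop (𝓝 l)) :
    ∃ chat ∈ C,
      (∀ y : X, Tendsto (fun n => ⟪c' n, y⟫) atTop (𝓝 ⟪chat, y⟫)) ∧
      (∀ c ∈ C, c ≠ chat →
        Filter.limsup (fun n => ‖c' n - chat‖) atTop <
          Filter.limsup (fun n => ‖c' n - c‖) atTop) := by
  obtain ⟨a, ha⟩ := hC
  obtain ⟨l, hl⟩ := hOpial a ha
  obtain ⟨B, hB⟩ := hl.bddAbove_range
  obtain ⟨x, hx⟩ := exists_weak_limit_of_cauchySeq_inner_self (u := fun n => c' n - a)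
    (fun n => hB ⟨n, rfl⟩) fun m =>
      cauchySeq_inner_sub_of_tendsto_norm_sub hl (hOpial (c' m) (hmem m)).choose_spec
  have hweak (y : X) : Tendsto (fun n => ⟪c' n, y⟫) atTop (𝓝 ⟪x + a, y⟫) := by
    simpa only [inner_sub_left, sub_add_cancel, inner_add_left] using (hx y).add_const ⟪a, y⟫
  have hxC : x + a ∈ C := mem_of_weak_limit_of_isClosed_of_convex hCclosed hCconv hmem hweak
  refine ⟨x + a, hxC, hweak, fun c hc hne => ?_⟩
  obtain ⟨r, hr⟩ := hOpial _ hxC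
  obtain ⟨s, hs⟩ := hOpial c hc
  rw [hr.limsup_eq, hs.limsup_eq]
  exact lt_of_tendsto_norm_sub_of_weak_limit hweak hne hr hs
end

section
/- Let X be a real Hilbert space, let C be a nonempty closed convex subset of X, and let (x_n) be a sequence in X that is Opial with respect to C and satisfies dist(x_n, C) → 0. For each n let p_n denote the nearest-point projection of x_n onto C, i.e. p_n ∈ C and ‖x_n − p_n‖ = dist(x_n, C). Then the sequence (p_n) is Opial with respect to C, for every c ∈ C one has lim_n ‖x_n − c‖ = lim_n ‖p_n − c‖, and (p_n) converges weakly to a point ĉ ∈ C satisfying limsup_n ‖x_n − ĉ‖ < limsup_n ‖x_n − c‖ for every c ∈ C with c ≠ ĉ. -/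
open Filter Topology RealInnerProductSpace

section WeakConvergence

variable {X : Type*} [NormedAddCommGroup X] [InnerProductSpace ℝ X]

/-- For a bounded sequence, the vectors against which it converges weakly form a closed set. -/
theorem isClosed_setOf_cauchySeq_inner {u : ℕ → X} {M : ℝ} (hu : ∀ n, ‖u n‖ ≤ M) :
    IsClosed {y : X | CauchySeq fun n => ⟪u n, y⟫} := by
  refine isClosed_of_closure_subset fun y hy => Metric.cauchySeq_iff'.2 fun ε hε => ?_
  have hM : 0 ≤ M := (norm_nonneg _).trans (hu 0)
  obtain ⟨z, hz, hyz⟩ := Metric.mem_closure_iff.1 hy (ε / (3 * (M + 1))) (by positivity)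
  obtain ⟨N, hN⟩ := Metric.cauchySeq_iff'.1 hz (ε / 3) (by positivity)
  have hbound : ∀ n, |⟪u n, y - z⟫| < ε / 3 := fun n => by
    rw [dist_eq_norm, lt_div_iff₀ (by positivity)] at hyz
    have h₁ := abs_real_inner_le_norm (u n) (y - z)
    have h₂ := mul_le_mul_of_nonneg_right (hu n) (norm_nonneg (y - z))
    nlinarith [norm_nonneg (y - z)]
  refine ⟨N, fun n hn => ?_⟩
  have h₁ := hN n hn
  have h₂ := hbound n
  have h₃ := hbound N
  rw [Real.dist_eq] at h₁ ⊢
  simp only [inner_sub_right] at h₂ h₃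
  rw [abs_lt] at *
  constructor <;> linarith

/-- A sequence whose inner products with every vector are Cauchy converges weakly. -/
theorem exists_tendsto_inner_of_cauchySeq_inner [CompleteSpace X] {u : ℕ → X}
    (hu : ∀ y, CauchySeq fun n => ⟪u n, y⟫) :
    ∃ z : X, ∀ y : X, Tendsto (fun n => ⟪u n, y⟫) atTop (𝓝 ⟪z, y⟫) := by
  choose f hf using fun y => cauchySeq_tendsto_of_complete (hu y)
  let F : X →L[ℝ] ℝ := continuousLinearMapOfTendsto (fun n => innerSL ℝ (u n))
    (f := f) (tendsto_pi_nhds.2 fun y => by simpa using hf y)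
  refine ⟨(InnerProductSpace.toDual ℝ X).symm F, fun y => ?_⟩
  rw [InnerProductSpace.toDual_symm_apply]
  exact hf y

/-- A bounded sequence in a Hilbert space that converges weakly against every element of a set
containing all its terms is weakly convergent. -/
theorem exists_tendsto_inner_of_bounded [CompleteSpace X] {u : ℕ → X} {M : ℝ} {S : Set X}
    (hM : ∀ n, ‖u n‖ ≤ M) (hmem : ∀ n, u n ∈ S)
    (hS : ∀ y ∈ S, CauchySeq fun n => ⟪u n, y⟫) :
    ∃ z : X, ∀ y : X, Tendsto (fun n => ⟪u n, y⟫) atTop (𝓝 ⟪z, y⟫) := by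
  refine exists_tendsto_inner_of_cauchySeq_inner fun y => ?_
  let V := (Submodule.span ℝ S).topologicalClosure
  have hspan : ∀ v ∈ Submodule.span ℝ S, CauchySeq fun n => ⟪u n, v⟫ := fun v hv => by
    induction hv using Submodule.span_induction with
    | mem v hv => exact hS v hv
    | zero => simpa using cauchySeq_const (0 : ℝ)
    | add v w _ _ hv hw => simpa only [inner_add_right, Pi.add_def] using hv.add hw
    | smul a v _ hv =>
      obtain ⟨l, hl⟩ := cauchySeq_tendsto_of_complete hv
      simpa only [real_inner_smul_right] using (hl.const_mul a).cauchySeq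
  have hV : ∀ v ∈ V, CauchySeq fun n => ⟪u n, v⟫ :=
    closure_minimal hspan (isClosed_setOf_cauchySeq_inner hM)
  have : CompleteSpace V := (Submodule.span ℝ S).isClosed_topologicalClosure.completeSpace_coe
  obtain ⟨v, hv, w, hw, rfl⟩ := V.exists_add_mem_mem_orthogonal y
  have huw : ∀ n, ⟪u n, w⟫ = 0 := fun n =>
    hw _ (Submodule.le_topologicalClosure _ (Submodule.subset_span (hmem n)))
  simpa only [inner_add_right, huw, add_zero] using hV v hv

/-- A closed convex subset of a Hilbert space is weakly sequentially closed. -/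
theorem IsClosed.mem_of_tendsto_inner [CompleteSpace X] {C : Set X} (hC : IsClosed C)
    (hconv : Convex ℝ C) {u : ℕ → X} (hu : ∀ n, u n ∈ C) {z : X}
    (hz : ∀ y : X, Tendsto (fun n => ⟪u n, y⟫) atTop (𝓝 ⟪z, y⟫)) : z ∈ C := by
  obtain ⟨v, hvC, hv⟩ := exists_norm_eq_iInf_of_complete_convex ⟨u 0, hu 0⟩ hC.isComplete hconv z
  have hle := (norm_eq_iInf_iff_real_inner_le_zero hconv hvC).1 hv
  have h : ⟪z, z - v⟫ ≤ ⟪v, z - v⟫ := le_of_tendsto' (hz (z - v)) fun n => by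
    have := hle (u n) (hu n)
    rw [real_inner_comm, inner_sub_left] at this
    linarith
  have hzv : ⟪z - v, z - v⟫ ≤ 0 := by rw [inner_sub_left]; linarith
  rwa [sub_eq_zero.1 (real_inner_self_nonpos.1 hzv)]

/-- An Opial sequence lying in a closed convex set `C` converges weakly to a point of `C`. -/
theorem exists_mem_tendsto_inner_of_opial [CompleteSpace X] {C : Set X} (hC : IsClosed C)
    (hconv : Convex ℝ C) {u : ℕ → X} (hu : ∀ n, u n ∈ C)
    (hO : ∀ c ∈ C, ∃ l : ℝ, Tendsto (fun n => ‖u n - c‖) atTop (𝓝 l)) :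
    ∃ z ∈ C, ∀ y : X, Tendsto (fun n => ⟪u n, y⟫) atTop (𝓝 ⟪z, y⟫) := by
  obtain ⟨l₀, hl₀⟩ := hO (u 0) (hu 0)
  obtain ⟨M, hM⟩ := hl₀.bddAbove_range
  obtain ⟨z, hz⟩ := exists_tendsto_inner_of_bounded (u := fun n => u n - u 0) (M := M)
    (S := (fun c => c - u 0) '' C) (fun n => hM ⟨n, rfl⟩) (fun n => ⟨u n, hu n, rfl⟩) (by
      rintro _ ⟨c, hc, rfl⟩
      obtain ⟨l, hl⟩ := hO c hc
      have h := (((hl₀.pow 2).sub (hl.pow 2)).add_const (‖c - u 0‖ ^ 2)).div_const 2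
      refine (h.congr fun n => ?_).cauchySeq
      have := norm_sub_sq_real (u n - u 0) (c - u 0)
      rw [sub_sub_sub_cancel_right] at this
      linarith)
  have hlim : ∀ y : X, Tendsto (fun n => ⟪u n, y⟫) atTop (𝓝 ⟪z + u 0, y⟫) := fun y => by
    simpa only [← inner_add_left, sub_add_cancel] using (hz y).add_const ⟪u 0, y⟫
  exact ⟨z + u 0, hC.mem_of_tendsto_inner hconv hu hlim, hlim⟩

/-- The Opial property: the weak limit is strictly closer to the tail of the sequence than any
other point. -/
theorem lt_of_tendsto_inner_of_tendsto_norm_sub {u : ℕ → X} {z c : X} {l m : ℝ}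
    (hz : ∀ y : X, Tendsto (fun n => ⟪u n, y⟫) atTop (𝓝 ⟪z, y⟫)) (hc : c ≠ z)
    (hl : Tendsto (fun n => ‖u n - z‖) atTop (𝓝 l))
    (hm : Tendsto (fun n => ‖u n - c‖) atTop (𝓝 m)) : l < m := by
  have hm0 : 0 ≤ m := ge_of_tendsto' hm fun n => norm_nonneg _
  have h : Tendsto (fun n => ‖u n - c‖ ^ 2) atTop
      (𝓝 (l ^ 2 - 2 * (⟪z, c - z⟫ - ⟪z, c - z⟫) + ‖c - z‖ ^ 2)) := by
    refine (((hl.pow 2).sub (((hz (c - z)).sub_const ⟪z, c - z⟫).const_mul 2)).add_const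
      (‖c - z‖ ^ 2)).congr fun n => ?_
    have := norm_sub_sq_real (u n - z) (c - z)
    rw [sub_sub_sub_cancel_right, inner_sub_left] at this
    exact this.symm
  have heq := tendsto_nhds_unique (hm.pow 2) h
  have hpos : 0 < ‖c - z‖ := norm_pos_iff.2 (sub_ne_zero.2 hc)
  exact lt_of_pow_lt_pow_left₀ 2 hm0 (by nlinarith)

end WeakConvergence

/-- If `(x n)` is Opial with respect to a nonempty closed convex set `C` and
`dist(x n, C) → 0`, then the projections `(p n)` form an Opial sequence with respect to
`C` with the same limits `lim ‖x n − c‖ = lim ‖p n − c‖`, and `(p n)` converges weakly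
to the asymptotic center of `(x n)` with respect to `C`. -/
theorem opial_dist_to_zero_projections
    {X : Type*} [NormedAddCommGroup X] [InnerProductSpace ℝ X] [CompleteSpace X]
    (C : Set X) (hC : C.Nonempty) (hCclosed : IsClosed C) (hCconv : Convex ℝ C)
    (x : ℕ → X)
    (hOpial : ∀ c ∈ C, ∃ l : ℝ, Tendsto (fun n => ‖x n - c‖) atTop (𝓝 l))
    (hdist : Tendsto (fun n => Metric.infDist (x n) C) atTop (𝓝 0))
    (p : ℕ → X)
    (hp : ∀ n, p n ∈ C ∧ ‖x n - p n‖ = Metric.infDist (x n) C) :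
    (∀ c ∈ C, ∃ l : ℝ,
        Tendsto (fun n => ‖x n - c‖) atTop (𝓝 l) ∧
        Tendsto (fun n => ‖p n - c‖) atTop (𝓝 l)) ∧
    (∃ chat ∈ C,
      (∀ y : X, Tendsto (fun n => ⟪p n, y⟫) atTop (𝓝 ⟪chat, y⟫)) ∧
      (∀ c ∈ C, c ≠ chat →
        Filter.limsup (fun n => ‖x n - chat‖) atTop <
          Filter.limsup (fun n => ‖x n - c‖) atTop)) := by
  have hxp : Tendsto (fun n => ‖x n - p n‖) atTop (𝓝 0) := by simpa only [(hp _).2] using hdist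
  have hlim : ∀ c ∈ C, ∃ l : ℝ, Tendsto (fun n => ‖x n - c‖) atTop (𝓝 l) ∧
      Tendsto (fun n => ‖p n - c‖) atTop (𝓝 l) := fun c hc => by
    obtain ⟨l, hl⟩ := hOpial c hc
    refine ⟨l, hl, ?_⟩
    have hdiff : Tendsto (fun n => ‖x n - c‖ - ‖p n - c‖) atTop (𝓝 0) :=
      squeeze_zero_norm (fun n => by
        simpa using abs_norm_sub_norm_le (x n - c) (p n - c)) hxp
    simpa using hl.sub hdiff
  obtain ⟨z, hzC, hz⟩ := exists_mem_tendsto_inner_of_opial hCclosed hCconv (fun n => (hp n).1)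
    fun c hc => (hlim c hc).imp fun _ h => h.2
  refine ⟨hlim, z, hzC, hz, fun c hc hcz => ?_⟩
  obtain ⟨l, hxl, hpl⟩ := hlim z hzC
  obtain ⟨m, hxm, hpm⟩ := hlim c hc
  rw [hxl.limsup_eq, hxm.limsup_eq]
  exact lt_of_tendsto_inner_of_tendsto_norm_sub hz hcz hpl hpm
end

section
/- Let X be a real Hilbert space, let C be a nonempty closed convex subset of X, and let (x_n) be a sequence in X that is Opial with respect to C. For each n let p_n denote the nearest-point projection of x_n onto C, i.e. p_n ∈ C and ‖x_n − p_n‖ = dist(x_n, C). If c̄ ∈ X is a strong cluster point of (p_n) (i.e. some subsequence of (p_n) converges to c̄ in norm), then c̄ ∈ C and lim_n ‖x_n − c̄‖ ≤ lim_n ‖x_n − c‖ for every c ∈ C; in particular, any two strong cluster points of (p_n) coincide. -/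
open Filter Topology

/-- A strong cluster point of the sequence of nearest points in `C` minimizes the limiting
distance over `C`. -/
theorem lim_norm_sub_le_of_tendsto_nearest {X : Type*} [NormedAddCommGroup X]
    {C : Set X} {x p : ℕ → X} (hp : ∀ n, ‖x n - p n‖ = Metric.infDist (x n) C)
    {a : X} {k : ℕ → ℕ} (hk : StrictMono k)
    (hpk : Tendsto (fun n => p (k n)) atTop (𝓝 a)) {c : X} (hc : c ∈ C) {l l' : ℝ}
    (hl : Tendsto (fun n => ‖x n - a‖) atTop (𝓝 l))
    (hl' : Tendsto (fun n => ‖x n - c‖) atTop (𝓝 l')) : l ≤ l' := by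
  have h : Tendsto (fun n => ‖x (k n) - c‖ + ‖p (k n) - a‖) atTop (𝓝 (l' + 0)) :=
    (hl'.comp hk.tendsto_atTop).add (tendsto_iff_norm_sub_tendsto_zero.1 hpk)
  rw [add_zero] at h
  refine le_of_tendsto_of_tendsto' (hl.comp hk.tendsto_atTop) h fun n => ?_
  have h₁ := norm_sub_le_norm_sub_add_norm_sub (x (k n)) (p (k n)) a
  have h₂ : Metric.infDist (x (k n)) C ≤ ‖x (k n) - c‖ := by
    simpa [dist_eq_norm] using Metric.infDist_le_dist_of_mem (x := x (k n)) hc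
  have h₃ := hp (k n)
  simp only [Function.comp_apply]
  linarith

/-- Apollonius' identity in a real inner product space. -/
theorem norm_sub_midpoint_sq {X : Type*} [NormedAddCommGroup X] [InnerProductSpace ℝ X]
    (x a b : X) :
    ‖x - midpoint ℝ a b‖ ^ 2 = (‖x - a‖ ^ 2 + ‖x - b‖ ^ 2) / 2 - ‖a - b‖ ^ 2 / 4 := by
  have h₁ := parallelogram_law_with_norm ℝ (x - a) (x - b)
  have h₂ : x - a + (x - b) = (2 : ℝ) • (x - midpoint ℝ a b) := by
    rw [smul_sub, midpoint_eq_smul_add, smul_smul, mul_invOf_self, one_smul, two_smul]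
    abel
  have h₃ : x - a - (x - b) = b - a := by abel
  rw [h₂, h₃, norm_smul, norm_sub_rev b a, Real.norm_ofNat] at h₁
  linarith

/-- Strong cluster points of the projected sequence: if `(x n)` is Opial with respect to
a nonempty closed convex set `C`, `p n` is the projection of `x n` onto `C`, and `cbar`
is a strong cluster point of `(p n)`, then `cbar ∈ C`,
`lim ‖x n - cbar‖ ≤ lim ‖x n - c‖` for every `c ∈ C`, and any two strong cluster points
of `(p n)` coincide. -/
theorem opial_projection_strong_cluster_points
    {X : Type*} [NormedAddCommGroup X] [InnerProductSpace ℝ X] [CompleteSpace X]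
    (C : Set X) (hC : C.Nonempty) (hCclosed : IsClosed C) (hCconv : Convex ℝ C)
    (x : ℕ → X)
    (hOpial : ∀ c ∈ C, ∃ l : ℝ, Tendsto (fun n => ‖x n - c‖) atTop (𝓝 l))
    (p : ℕ → X)
    (hp : ∀ n, p n ∈ C ∧ ‖x n - p n‖ = Metric.infDist (x n) C)
    (cbar : X)
    (hcbar : ∃ k : ℕ → ℕ, StrictMono k ∧ Tendsto (fun n => p (k n)) atTop (𝓝 cbar)) :
    cbar ∈ C ∧
    (∀ c ∈ C, ∀ l l' : ℝ,
      Tendsto (fun n => ‖x n - cbar‖) atTop (𝓝 l) →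
      Tendsto (fun n => ‖x n - c‖) atTop (𝓝 l') → l ≤ l') ∧
    (∀ cbar' : X,
      (∃ k : ℕ → ℕ, StrictMono k ∧ Tendsto (fun n => p (k n)) atTop (𝓝 cbar')) →
      cbar' = cbar) := by
  have hmem : ∀ a : X, (∃ k : ℕ → ℕ, StrictMono k ∧
      Tendsto (fun n => p (k n)) atTop (𝓝 a)) → a ∈ C := fun a ⟨k, _, hpk⟩ =>
    hCclosed.mem_of_tendsto hpk (Eventually.of_forall fun n => (hp (k n)).1)
  have hmin : ∀ a : X, (∃ k : ℕ → ℕ, StrictMono k ∧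
      Tendsto (fun n => p (k n)) atTop (𝓝 a)) → ∀ c ∈ C, ∀ l l' : ℝ,
      Tendsto (fun n => ‖x n - a‖) atTop (𝓝 l) →
      Tendsto (fun n => ‖x n - c‖) atTop (𝓝 l') → l ≤ l' :=
    fun a ⟨_, hk, hpk⟩ c hc l l' hl hl' =>
      lim_norm_sub_le_of_tendsto_nearest (fun n => (hp n).2) hk hpk hc hl hl'
  refine ⟨hmem cbar hcbar, hmin cbar hcbar, fun b hb => ?_⟩
  have hmC : midpoint ℝ b cbar ∈ C := hCconv.midpoint_mem (hmem b hb) (hmem cbar hcbar)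
  obtain ⟨l, hl⟩ := hOpial cbar (hmem cbar hcbar)
  obtain ⟨l', hl'⟩ := hOpial b (hmem b hb)
  obtain ⟨m, hm⟩ := hOpial _ hmC
  have hlm : l ≤ m := hmin cbar hcbar _ hmC _ _ hl hm
  have hlm' : l' ≤ m := hmin b hb _ hmC _ _ hl' hm
  have hl0 : 0 ≤ l := ge_of_tendsto' hl fun n => norm_nonneg _
  have hl0' : 0 ≤ l' := ge_of_tendsto' hl' fun n => norm_nonneg _
  have hsq : m ^ 2 = (l' ^ 2 + l ^ 2) / 2 - ‖b - cbar‖ ^ 2 / 4 := by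
    refine tendsto_nhds_unique (hm.pow 2) ?_
    simp only [norm_sub_midpoint_sq]
    exact (((hl'.pow 2).add (hl.pow 2)).div_const 2).sub_const _
  have h₁ : l ^ 2 ≤ m ^ 2 := by gcongr
  have h₂ : l' ^ 2 ≤ m ^ 2 := by gcongr
  have h₃ : ‖b - cbar‖ ^ 2 = 0 := le_antisymm (by linarith) (sq_nonneg _)
  exact sub_eq_zero.1 (norm_eq_zero.1 (pow_eq_zero_iff two_ne_zero |>.1 h₃))
end

section
/- Let X be a real Hilbert space, let C be a nonempty closed convex subset of X, and let (x_n) be a sequence in X that is Opial with respect to C and whose range {x_n : n ∈ ℕ} is relatively compact (its closure is compact). Then the real sequence (dist(x_n, C)) converges and lim_n dist(x_n, C) = min_{c ∈ C} lim_n ‖x_n − c‖; that is, there exists ĉ ∈ C with lim_n dist(x_n, C) = lim_n ‖x_n − ĉ‖ ≤ lim_n ‖x_n − c‖ for every c ∈ C. -/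
open Filter Topology

/-- If the distances of a sequence to `c` converge, their limit is the distance from `c` to any
subsequential limit. -/
theorem eq_norm_sub_of_tendsto_subseq {X : Type*} [NormedAddCommGroup X] {x : ℕ → X} {φ : ℕ → ℕ}
    {y c : X} {l : ℝ} (hφ : Tendsto φ atTop atTop) (hy : Tendsto (x ∘ φ) atTop (𝓝 y))
    (hl : Tendsto (fun n => ‖x n - c‖) atTop (𝓝 l)) : l = ‖y - c‖ :=
  tendsto_nhds_unique (hl.comp hφ) (hy.sub_const c).norm

/-- If `(x n)` is Opial with respect to a nonempty closed convex set `C` and its range is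
relatively compact, then `(dist(x n, C))` converges and its limit equals
`min_{c ∈ C} lim ‖x n - c‖`. -/
theorem opial_relatively_compact_dist_convergence
    {X : Type*} [NormedAddCommGroup X] [InnerProductSpace ℝ X] [CompleteSpace X]
    (C : Set X) (hC : C.Nonempty) (hCclosed : IsClosed C) (hCconv : Convex ℝ C)
    (x : ℕ → X)
    (hOpial : ∀ c ∈ C, ∃ l : ℝ, Tendsto (fun n => ‖x n - c‖) atTop (𝓝 l))
    (hcompact : IsCompact (closure (Set.range x))) :
    ∃ chat ∈ C, ∃ l : ℝ,
      Tendsto (fun n => Metric.infDist (x n) C) atTop (𝓝 l) ∧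
      Tendsto (fun n => ‖x n - chat‖) atTop (𝓝 l) ∧
      (∀ c ∈ C, ∀ l' : ℝ, Tendsto (fun n => ‖x n - c‖) atTop (𝓝 l') → l ≤ l') := by
  have hsub : ∀ ns : ℕ → ℕ, ∃ z, ∃ φ : ℕ → ℕ, StrictMono φ ∧
      Tendsto ((x ∘ ns) ∘ φ) atTop (𝓝 z) := fun ns => by
    obtain ⟨z, -, φ, hφ, hz⟩ := hcompact.tendsto_subseq (x := x ∘ ns)
      fun n => subset_closure (Set.mem_range_self (ns n))
    exact ⟨z, φ, hφ, hz⟩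
  obtain ⟨y, φ, hφ, hy⟩ := hsub id
  obtain ⟨p, hp, hpy⟩ := exists_norm_eq_iInf_of_complete_convex hC hCclosed.isComplete hCconv y
  have hpdist : Metric.infDist y C = ‖y - p‖ := by
    simp only [hpy, Metric.infDist_eq_iInf, dist_eq_norm]
  refine ⟨p, hp, ‖y - p‖, ?_, ?_, ?_⟩
  · refine tendsto_of_subseq_tendsto fun ns hns => ?_
    obtain ⟨z, ψ, hψ, hz⟩ := hsub ns
    refine ⟨ψ, ?_⟩
    have hzy : Metric.infDist z C = ‖y - p‖ := by
      rw [← hpdist, Metric.infDist_eq_iInf, Metric.infDist_eq_iInf]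
      refine iInf_congr fun c => ?_
      obtain ⟨l, hl⟩ := hOpial c c.2
      rw [dist_eq_norm, dist_eq_norm, ← eq_norm_sub_of_tendsto_subseq hφ.tendsto_atTop hy hl,
        ← eq_norm_sub_of_tendsto_subseq (hns.comp hψ.tendsto_atTop) hz hl]
    rw [← hzy]
    exact ((Metric.continuous_infDist_pt C).tendsto z).comp hz
  · obtain ⟨l, hl⟩ := hOpial p hp
    rwa [← eq_norm_sub_of_tendsto_subseq hφ.tendsto_atTop hy hl]
  · intro c hc l' hl'
    rw [eq_norm_sub_of_tendsto_subseq hφ.tendsto_atTop hy hl', ← hpdist, ← dist_eq_norm]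
    exact Metric.infDist_le_dist_of_mem hc
end

section
/- Let X be a real Hilbert space, let C be a nonempty closed affine subspace of X (the translate of a closed linear subspace), and let (x_n) be a sequence in X that is Opial with respect to C. For each n let p_n denote the nearest-point projection of x_n onto C, i.e. p_n ∈ C and ‖x_n − p_n‖ = dist(x_n, C). Then (p_n) converges weakly to a point ĉ ∈ C, and ĉ satisfies limsup_n ‖x_n − ĉ‖ < limsup_n ‖x_n − c‖ for every c ∈ C with c ≠ ĉ. -/
open Filter Topology RealInnerProductSpace

/-- A sequence in a Hilbert space whose inner products with every vector converge has a
weak limit. -/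
theorem exists_tendsto_inner_of_forall_exists_tendsto_inner
    {H : Type*} [NormedAddCommGroup H] [InnerProductSpace ℝ H] [CompleteSpace H]
    (q : ℕ → H) (h : ∀ y : H, ∃ l : ℝ, Tendsto (fun n => ⟪q n, y⟫) atTop (𝓝 l)) :
    ∃ v : H, ∀ y : H, Tendsto (fun n => ⟪q n, y⟫) atTop (𝓝 ⟪v, y⟫) := by
  choose f hf using h
  let F : H →L[ℝ] ℝ := continuousLinearMapOfTendsto (f := f) (fun n => innerSL ℝ (q n))
    (tendsto_pi_nhds.2 hf)
  refine ⟨(InnerProductSpace.toDual ℝ H).symm F, fun y => ?_⟩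
  rw [InnerProductSpace.toDual_symm_apply]
  exact hf y

/-- A vector realizing the distance from `u` to a subspace has residual orthogonal to the
subspace. -/
theorem Submodule.inner_sub_eq_zero_of_norm_sub_eq_infDist
    {X : Type*} [NormedAddCommGroup X] [InnerProductSpace ℝ X] (Y : Submodule ℝ X)
    {u v : X} (hv : v ∈ Y) (h : ‖u - v‖ = Metric.infDist u (Y : Set X)) :
    ∀ y ∈ Y, ⟪u - v, y⟫ = 0 := by
  refine (Y.norm_eq_iInf_iff_real_inner_eq_zero hv).1 ?_
  rw [h, Metric.infDist_eq_iInf]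
  simp only [dist_eq_norm]

/-- If the distances from `x n` to `a` and to `c` both converge and their squares differ by a
positive amount in the limit, then their limits superior are strictly ordered. -/
theorem limsup_norm_sub_lt_limsup_norm_sub
    {X : Type*} [NormedAddCommGroup X] {x : ℕ → X} {a c : X} {la lc d : ℝ}
    (ha : Tendsto (fun n => ‖x n - a‖) atTop (𝓝 la))
    (hc : Tendsto (fun n => ‖x n - c‖) atTop (𝓝 lc)) (hd : 0 < d)
    (h : Tendsto (fun n => ‖x n - c‖ ^ 2 - ‖x n - a‖ ^ 2) atTop (𝓝 d)) :
    limsup (fun n => ‖x n - a‖) atTop < limsup (fun n => ‖x n - c‖) atTop := by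
  rw [ha.limsup_eq, hc.limsup_eq]
  have hlc : 0 ≤ lc := ge_of_tendsto' hc fun n => norm_nonneg _
  have hdiff := tendsto_nhds_unique h ((hc.pow 2).sub (ha.pow 2))
  exact lt_of_pow_lt_pow_left₀ 2 hlc (by linarith)

/-- Projections onto an affine Opial set: if `C` is a closed affine subspace (a translate
of a closed linear subspace) and `(x n)` is Opial with respect to `C`, then the
projections `(p n)` of `(x n)` onto `C` converge weakly to the asymptotic center of
`(x n)` with respect to `C`. -/
theorem opial_projection_onto_affine_weak_convergence
    {X : Type*} [NormedAddCommGroup X] [InnerProductSpace ℝ X] [CompleteSpace X]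
    (Y : Submodule ℝ X) (hY : IsClosed (Y : Set X)) (z : X)
    (C : Set X) (hCdef : C = (fun y => z + y) '' (Y : Set X))
    (x : ℕ → X)
    (hOpial : ∀ c ∈ C, ∃ l : ℝ, Tendsto (fun n => ‖x n - c‖) atTop (𝓝 l))
    (p : ℕ → X)
    (hp : ∀ n, p n ∈ C ∧ ‖x n - p n‖ = Metric.infDist (x n) C) :
    ∃ chat ∈ C,
      (∀ y : X, Tendsto (fun n => ⟪p n, y⟫) atTop (𝓝 ⟪chat, y⟫)) ∧
      (∀ c ∈ C, c ≠ chat →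
        Filter.limsup (fun n => ‖x n - chat‖) atTop <
          Filter.limsup (fun n => ‖x n - c‖) atTop) := by
  subst hCdef
  have : CompleteSpace Y := hY.completeSpace_coe
  have hmem (y : Y) : z + (y : X) ∈ (fun y => z + y) '' (Y : Set X) := ⟨y, y.2, rfl⟩
  have hq : ∀ n, ∃ q : Y, z + (q : X) = p n := fun n => by
    obtain ⟨y, hy, hyp⟩ := (hp n).1
    exact ⟨⟨y, hy⟩, hyp⟩
  choose q hq using hq
  have hinner (n : ℕ) (y : Y) : ⟪x n - z, (y : X)⟫ = ⟪q n, y⟫ := by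
    have hdist : ‖(x n - z) - (q n : X)‖ = Metric.infDist (x n - z) (Y : Set X) := by
      have h := Metric.infDist_image (isometry_add_left z) (x := x n - z) (t := (Y : Set X))
      rw [add_sub_cancel] at h
      rw [sub_sub, hq, (hp n).2]
      exact h
    have h := Y.inner_sub_eq_zero_of_norm_sub_eq_infDist (q n).2 hdist y y.2
    rw [inner_sub_left, sub_eq_zero] at h
    exact h
  have hnorm (n : ℕ) (y : Y) :
      ‖x n - (z + y)‖ ^ 2 = ‖x n - z‖ ^ 2 - 2 * ⟪q n, y⟫ + ‖y‖ ^ 2 := by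
    rw [← sub_sub, norm_sub_sq_real, hinner, Submodule.coe_norm]
  obtain ⟨v, hv⟩ := exists_tendsto_inner_of_forall_exists_tendsto_inner q fun y => by
    obtain ⟨l, hl⟩ := hOpial _ (hmem y)
    obtain ⟨l₀, hl₀⟩ := hOpial _ (hmem 0)
    refine ⟨_, ((((hl₀.pow 2).sub (hl.pow 2)).add_const (‖y‖ ^ 2)).div_const 2).congr
      fun n => ?_⟩
    rw [hnorm, hnorm, inner_zero_right, norm_zero]
    ring
  refine ⟨z + v, hmem v, fun y => ?_, ?_⟩
  · have hP (w : Y) : ⟪z + (w : X), y⟫ = ⟪z, y⟫ + ⟪w, Y.orthogonalProjectionOnto y⟫ := by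
      rw [inner_add_left, Submodule.inner_orthogonalProjectionOnto_eq_of_mem_left]
    simp only [← hq, hP]
    exact (hv _).const_add _
  · rintro _ ⟨y, hy, rfl⟩ hne
    lift y to Y using hy
    obtain ⟨lc, hlc⟩ := hOpial _ (hmem y)
    obtain ⟨lv, hlv⟩ := hOpial _ (hmem v)
    have hyv : y - v ≠ 0 := fun h => hne (by rw [sub_eq_zero.1 h])
    refine limsup_norm_sub_lt_limsup_norm_sub hlv hlc (d := ‖y - v‖ ^ 2) (by positivity) ?_
    have h := ((hv (v - y)).const_mul 2).add_const (‖y‖ ^ 2 - ‖v‖ ^ 2)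
    have hd : 2 * ⟪v, v - y⟫ + (‖y‖ ^ 2 - ‖v‖ ^ 2) = ‖y - v‖ ^ 2 := by
      rw [norm_sub_sq_real, inner_sub_right, real_inner_self_eq_norm_sq, real_inner_comm]
      ring
    rw [hd] at h
    refine h.congr fun n => ?_
    rw [hnorm, hnorm, inner_sub_right]
    ring
end
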